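/- Let A ∈ GL_n(ℚ) and let L ≤ ℤ^n ∩ A⁻¹(ℤ^n) be a finite-index subgroup with L ≠ ℤ^n and AL ≠ ℤ^n, and let H = ⟨x_1,…,x_n⟩ be the base subgroup of G := G(A,L). Then the set H_1 = {g ∈ H ∣ C_G(g) ≠ H} is equal to {x^v ∣ v ∈ AL ∪ L}. In particular, H_1 is a subgroup of H if and only if either AL ⊆ L or L ⊆ AL. -/

import Mathlib

open Matrix

noncomputable section

/-- The coercion `ℤ^n → ℚ^n` as an additive homomorphism. -/
def ZtoQ (n : ℕ) : (Fin n → ℤ) →+ (Fin n → ℚ) :=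
  AddMonoidHom.mk' (fun v i => (v i : ℚ)) (by intro a b; funext i; simp)

/-- The image `A·L ⊆ ℚ^n` of a subgroup `L ≤ ℤ^n` under the matrix `A`. -/
def QImage {n : ℕ} (A : Matrix (Fin n) (Fin n) ℚ) (L : AddSubgroup (Fin n → ℤ)) :
    AddSubgroup (Fin n → ℚ) :=
  (L.map (ZtoQ n)).map A.mulVecLin.toAddMonoidHom

/-- The subgroup `AL` of `ℤ^n`, i.e. the set of integer vectors lying in `A·L`. -/
def ALsub {n : ℕ} (A : Matrix (Fin n) (Fin n) ℚ) (L : AddSubgroup (Fin n → ℤ)) :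
    AddSubgroup (Fin n → ℤ) :=
  (QImage A L).comap (ZtoQ n)

/-- `x^v = x_1^{v_1} ⋯ x_n^{v_n}` in the free group on `x_1,…,x_n,t`. -/
def xWord (n : ℕ) (v : Fin n → ℤ) : FreeGroup (Fin n ⊕ Unit) :=
  (List.ofFn fun i => (FreeGroup.of (Sum.inl i) : FreeGroup (Fin n ⊕ Unit)) ^ (v i)).prod

/-- The relations of the Leary–Minasyan group `G(A,L)`. -/
def LMrels (n : ℕ) (A : Matrix (Fin n) (Fin n) ℚ) (L : AddSubgroup (Fin n → ℤ)) :
    Set (FreeGroup (Fin n ⊕ Unit)) :=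
  {r | (∃ i j : Fin n,
          r = FreeGroup.of (Sum.inl i) * FreeGroup.of (Sum.inl j) *
              (FreeGroup.of (Sum.inl i))⁻¹ * (FreeGroup.of (Sum.inl j))⁻¹) ∨
       (∃ v ∈ L, ∃ w : Fin n → ℤ, ZtoQ n w = A.mulVec (ZtoQ n v) ∧
          r = FreeGroup.of (Sum.inr ()) * xWord n v * (FreeGroup.of (Sum.inr ()))⁻¹ *
              (xWord n w)⁻¹)}

/-- The Leary–Minasyan group `G(A,L)`. -/
abbrev LM (n : ℕ) (A : Matrix (Fin n) (Fin n) ℚ) (L : AddSubgroup (Fin n → ℤ)) :=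
  PresentedGroup (LMrels n A L)

/-- The generator `x_i` of `G(A,L)`. -/
def Xg (n : ℕ) (A : Matrix (Fin n) (Fin n) ℚ) (L : AddSubgroup (Fin n → ℤ)) (i : Fin n) :
    LM n A L :=
  PresentedGroup.of (Sum.inl i)

/-- The stable letter `t` of `G(A,L)`. -/
def Tg (n : ℕ) (A : Matrix (Fin n) (Fin n) ℚ) (L : AddSubgroup (Fin n → ℤ)) : LM n A L :=
  PresentedGroup.of (Sum.inr ())

/-- The element `x^v` of `G(A,L)`. -/
def Xv (n : ℕ) (A : Matrix (Fin n) (Fin n) ℚ) (L : AddSubgroup (Fin n → ℤ)) (v : Fin n → ℤ) :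
    LM n A L :=
  (List.ofFn fun i => (Xg n A L i) ^ (v i)).prod

/-- The base subgroup `H = ⟨x_1,…,x_n⟩` of `G(A,L)`. -/
def Hsub (n : ℕ) (A : Matrix (Fin n) (Fin n) ℚ) (L : AddSubgroup (Fin n → ℤ)) :
    Subgroup (LM n A L) :=
  Subgroup.closure (Set.range (Xg n A L))

/-- The set `⋃_{j∈ℤ} A^j(ℤ^n) ⊆ ℚ^n`. -/
def unionSet {n : ℕ} (A : Matrix (Fin n) (Fin n) ℚ) : Set (Fin n → ℚ) :=
  ⋃ j : ℤ, (A ^ j).mulVec '' Set.range (ZtoQ n)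

/-- Cast an integer matrix to a rational matrix. -/
def QMat {k : ℕ} (M : Matrix (Fin k) (Fin k) ℤ) : Matrix (Fin k) (Fin k) ℚ :=
  M.map (Int.cast)

/-- The block matrix `[[1, 0ᵀ],[u, C]]`. -/
def blockOne {k : ℕ} (u : Fin k → ℤ) (C : Matrix (Fin k) (Fin k) ℤ) :
    Matrix (Fin (k+1)) (Fin (k+1)) ℤ :=
  Matrix.of fun i j =>
    Fin.cases (Fin.cases 1 (fun _ => 0) j) (fun i' => Fin.cases (u i') (fun j' => C i' j') j) i

/-- Transport a subgroup of `ℤ^a` along an equality `a = b` of dimensions. -/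
def reindexSub {a b : ℕ} (h : a = b) (L : AddSubgroup (Fin a → ℤ)) :
    AddSubgroup (Fin b → ℤ) :=
  L.map (AddMonoidHom.mk' (fun v => v ∘ (finCongr h).symm) (fun _ _ => rfl))


namespace HNNExtension

open NormalWord

variable {G : Type*} [CommGroup G] {A B : Subgroup G} {φ : A ≃* B}

theorem mem_range_of_of_commute {a : G} (hA : a ∉ A) (hB : a ∉ B)
    {g : HNNExtension G A B φ} (h : Commute g (of a)) :
    g ∈ (of.range : Subgroup (HNNExtension G A B φ)) := by
  obtain ⟨d⟩ := TransversalPair.nonempty G A B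
  obtain ⟨⟨k, l, hl⟩, rfl⟩ : ∃ w : ReducedWord G A B, w.prod φ = g :=
    ⟨(g • (NormalWord.empty : NormalWord d)).toReducedWord, by simp⟩
  rcases List.eq_nil_or_concat' l with rfl | ⟨l, x, rfl⟩
  · exact ⟨k, by simp [ReducedWord.prod]⟩
  exfalso
  have hl' : (l ++ [(x.1, x.2 * a)]).IsChain
      (fun a b => a.2 ∈ toSubgroup A B a.1 → a.1 = b.1) := by
    rw [List.isChain_append] at hl ⊢
    refine ⟨hl.1, by simp, fun y hy z hz => ?_⟩
    obtain rfl : (x.1, x.2 * a) = z := by simpa using hz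
    exact hl.2.2 y hy x (by simp)
  have key := (ReducedWord.map_fst_eq_and_of_prod_eq φ
    (w₁ := ⟨a * k, l ++ [x], hl⟩) (w₂ := ⟨k, l ++ [(x.1, x.2 * a)], hl'⟩) (by
      have := h.eq
      simp only [ReducedWord.prod, List.map_append, List.prod_append, List.map_cons,
        List.map_nil, List.prod_singleton, map_mul, mul_assoc] at this ⊢
      exact this.symm)).2
  obtain ⟨u, hu⟩ : ∃ u, u ∈ ((l ++ [x]).head?.map Prod.fst) := by
    cases l <;> simp
  have hmem := key u hu
  have hk : (a * k)⁻¹ * k = a⁻¹ := by simp [mul_comm]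
  rw [hk, inv_mem_iff] at hmem
  rcases Int.units_eq_one_or u with rfl | rfl
  · exact hB hmem
  · exact hA (by simpa using hmem)

theorem conj_t_not_mem_range {b : G} (u : ℤˣ) (hb : b ∉ toSubgroup A B u) :
    t ^ (u : ℤ) * of b * t ^ (-u : ℤ) ∉ (of.range : Subgroup (HNNExtension G A B φ)) := by
  intro h
  have := ReducedWord.toList_eq_nil_of_mem_of_range φ
    (⟨1, [(u, b), (-u, 1)], by simp [hb]⟩ : ReducedWord G A B)
    (by simpa [ReducedWord.prod, mul_assoc] using h)
  simp at this

theorem range_le_centralizer (a : G) :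
    (of.range : Subgroup (HNNExtension G A B φ)) ≤ Subgroup.centralizer {of a} := by
  rintro _ ⟨g, rfl⟩
  rw [Subgroup.mem_centralizer_singleton_iff, ← map_mul, ← map_mul, mul_comm]

theorem centralizer_of_eq_range_iff (hA : A ≠ ⊤) (hB : B ≠ ⊤) (a : G) :
    Subgroup.centralizer {(of a : HNNExtension G A B φ)} = of.range ↔ a ∉ A ∧ a ∉ B := by
  refine ⟨fun h => ⟨fun ha => ?_, fun ha => ?_⟩, fun h => ?_⟩
  · obtain ⟨b, hb⟩ := not_forall.1 (mt (Subgroup.eq_top_iff' B).2 hB)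
    refine conj_t_not_mem_range (φ := φ) (-1) (b := b) (by simpa using hb) ?_
    rw [← h, Subgroup.mem_centralizer_singleton_iff]
    have e : (of a : HNNExtension G A B φ) = t⁻¹ * of (φ ⟨a, ha⟩ : G) * t := by
      rw [equiv_eq_conj]; group
    have c := congrArg (of : G →* HNNExtension G A B φ) (mul_comm b (φ ⟨a, ha⟩ : G))
    rw [map_mul, map_mul] at c
    rw [e]
    simp only [Units.val_neg, Units.val_one, neg_neg, _root_.zpow_neg, zpow_one]
    calc t⁻¹ * of b * t * (t⁻¹ * of (φ ⟨a, ha⟩ : G) * t)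
        = t⁻¹ * (of b * of (φ ⟨a, ha⟩ : G)) * t := by group
      _ = _ := by rw [c]; group
  · obtain ⟨b, hb⟩ := not_forall.1 (mt (Subgroup.eq_top_iff' A).2 hA)
    refine conj_t_not_mem_range (φ := φ) 1 (b := b) (by simpa using hb) ?_
    rw [← h, Subgroup.mem_centralizer_singleton_iff]
    have e : (of a : HNNExtension G A B φ) = t * of (φ.symm ⟨a, ha⟩ : G) * t⁻¹ := by
      rw [equiv_symm_eq_conj]; group
    have c := congrArg (of : G →* HNNExtension G A B φ) (mul_comm b (φ.symm ⟨a, ha⟩ : G))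
    rw [map_mul, map_mul] at c
    rw [e]
    simp only [Units.val_one, _root_.zpow_neg, zpow_one]
    calc t * of b * t⁻¹ * (t * of (φ.symm ⟨a, ha⟩ : G) * t⁻¹)
        = t * (of b * of (φ.symm ⟨a, ha⟩ : G)) * t⁻¹ := by group
      _ = _ := by rw [c]; group
  · refine le_antisymm (fun g hg => ?_) (range_le_centralizer a)
    exact mem_range_of_of_commute h.1 h.2 (Subgroup.mem_centralizer_singleton_iff.1 hg)

end HNNExtension

theorem Commute.prod_ofFn_zpow_add {G : Type*} [Group G] {n : ℕ} {f : Fin n → G}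
    (hf : ∀ i j, Commute (f i) (f j)) (v w : Fin n → ℤ) :
    (List.ofFn fun i => f i ^ (v + w) i).prod =
      (List.ofFn fun i => f i ^ v i).prod * (List.ofFn fun i => f i ^ w i).prod := by
  induction n with
  | zero => simp
  | succ n ih =>
    have hc : Commute (f 0 ^ w 0) (List.ofFn fun i : Fin n => f i.succ ^ v i.succ).prod := by
      refine Commute.list_prod_right _ _ fun x hx => ?_
      obtain ⟨i, rfl⟩ := List.mem_ofFn.1 hx
      exact ((hf 0 i.succ).zpow_right _).zpow_left _
    have ih' := ih (f := fun i => f i.succ) (fun i j => hf i.succ j.succ)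
      (fun i => v i.succ) (fun i => w i.succ)
    simp only [Pi.add_apply] at ih'
    simp only [List.ofFn_succ, List.prod_cons, Pi.add_apply, ih']
    rw [_root_.zpow_add, mul_assoc, mul_assoc, ← mul_assoc (f 0 ^ w 0), hc.eq]
    simp only [mul_assoc]

theorem map_prod_ofFn_zpow {G K : Type*} [Group G] [Group K] (F : G →* K) {n : ℕ}
    (f : Fin n → G) (v : Fin n → ℤ) :
    F (List.ofFn fun i => f i ^ v i).prod = (List.ofFn fun i => F (f i) ^ v i).prod := by
  rw [map_list_prod, List.map_ofFn]
  simp [Function.comp_def]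

theorem prod_ofFn_zpow_single {G : Type*} [Group G] {n : ℕ} (f : Fin n → G) (i : Fin n) :
    (List.ofFn fun j => f j ^ (Pi.single i (1 : ℤ) : Fin n → ℤ) j).prod = f i := by
  induction n with
  | zero => exact i.elim0
  | succ n ih =>
    rw [List.ofFn_succ, List.prod_cons]
    refine Fin.cases ?_ (fun k => ?_) i
    · rw [List.prod_eq_one]
      · simp
      · simp [Fin.succ_ne_zero]
    · rw [← ih (fun j => f j.succ) k]
      simp [Pi.single_apply]

theorem prod_ofFn_single_zpow {n : ℕ} (v : Fin n → ℤ) :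
    (List.ofFn fun i => Multiplicative.ofAdd (Pi.single i (1 : ℤ) : Fin n → ℤ) ^ v i).prod =
      Multiplicative.ofAdd v := by
  rw [List.prod_ofFn]
  apply Multiplicative.toAdd.injective
  rw [toAdd_prod]
  simp only [toAdd_zpow, toAdd_ofAdd]
  conv_rhs => rw [← Finset.univ_sum_single v]
  refine Finset.sum_congr rfl fun i _ => ?_
  rw [← Pi.single_smul]
  simp

section LM

variable {n : ℕ} {A : Matrix (Fin n) (Fin n) ℚ} {L : AddSubgroup (Fin n → ℤ)}

theorem ZtoQ_injective (n : ℕ) : Function.Injective (ZtoQ n) := by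
  intro v w h
  funext i
  exact Int.cast_injective (α := ℚ) (congrFun h i)

theorem mem_ALsub {w : Fin n → ℤ} :
    w ∈ ALsub A L ↔ ∃ v ∈ L, A *ᵥ ZtoQ n v = ZtoQ n w := by
  simp [ALsub, QImage]

theorem Xg_commute (i j : Fin n) : Commute (Xg n A L i) (Xg n A L j) := by
  have h := PresentedGroup.one_of_mem (rels := LMrels n A L) (Or.inl ⟨i, j, rfl⟩)
  simp only [map_mul, map_inv] at h
  exact (mul_inv_eq_iff_eq_mul.1 (mul_inv_eq_one.1 h))

theorem mk_xWord (v : Fin n → ℤ) : PresentedGroup.mk (LMrels n A L) (xWord n v) = Xv n A L v :=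
  map_prod_ofFn_zpow _ _ v

theorem Tg_conj {v w : Fin n → ℤ} (hv : v ∈ L) (h : ZtoQ n w = A *ᵥ ZtoQ n v) :
    Tg n A L * Xv n A L v = Xv n A L w * Tg n A L := by
  have h := PresentedGroup.one_of_mem (rels := LMrels n A L) (Or.inr ⟨v, hv, w, h, rfl⟩)
  simp only [map_mul, map_inv, mk_xWord] at h
  exact (mul_inv_eq_iff_eq_mul.1 (mul_inv_eq_one.1 h))

variable (n A L) in
/-- The homomorphism `v ↦ x^v` from `ℤ^n` to `G(A,L)`. -/
def XvHom : Multiplicative (Fin n → ℤ) →* LM n A L :=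
  MonoidHom.mk' (fun v => Xv n A L v.toAdd) fun v w =>
    Commute.prod_ofFn_zpow_add Xg_commute v.toAdd w.toAdd

theorem XvHom_ofAdd (v : Fin n → ℤ) : XvHom n A L (Multiplicative.ofAdd v) = Xv n A L v := rfl

theorem XvHom_single (i : Fin n) :
    XvHom n A L (Multiplicative.ofAdd (Pi.single i 1)) = Xg n A L i := by
  exact prod_ofFn_zpow_single (Xg n A L) i

theorem Hsub_eq_range : Hsub n A L = (XvHom n A L).range := by
  apply le_antisymm
  · rw [Hsub, Subgroup.closure_le]
    rintro _ ⟨i, rfl⟩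
    exact ⟨_, XvHom_single i⟩
  · rintro _ ⟨v, rfl⟩
    refine Subgroup.list_prod_mem _ fun x hx => ?_
    obtain ⟨i, rfl⟩ := List.mem_ofFn.1 hx
    exact Subgroup.zpow_mem _ (Subgroup.subset_closure (Set.mem_range_self i)) _

theorem exists_mulEquiv_ALsub (hA : IsUnit A.det) (hLA : QImage A L ≤ (ZtoQ n).range) :
    ∃ φ : L.toSubgroup ≃* (ALsub A L).toSubgroup,
      ∀ a, ZtoQ n (φ a : Multiplicative (Fin n → ℤ)).toAdd =
        A *ᵥ ZtoQ n (a : Multiplicative (Fin n → ℤ)).toAdd := by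
  have hex : ∀ a : L.toSubgroup, ∃ w : (ALsub A L).toSubgroup,
      ZtoQ n (w : Multiplicative (Fin n → ℤ)).toAdd =
        A *ᵥ ZtoQ n (a : Multiplicative (Fin n → ℤ)).toAdd := by
    intro a
    obtain ⟨w, hw⟩ := hLA (AddSubgroup.mem_map_of_mem _ (AddSubgroup.mem_map_of_mem _ a.2))
    exact ⟨⟨Multiplicative.ofAdd w, mem_ALsub.2 ⟨_, a.2, hw.symm⟩⟩, hw⟩
  choose f hf using hex
  refine ⟨MulEquiv.ofBijective (MonoidHom.mk' f fun a b => ?_) ⟨fun a b hab => ?_, fun w => ?_⟩, hf⟩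
  · apply Subtype.ext
    apply Multiplicative.toAdd.injective
    apply ZtoQ_injective
    rw [hf]
    simp only [Subgroup.coe_mul, toAdd_mul, map_add, hf, Matrix.mulVec_add]
  · have h : ZtoQ n (f a : Multiplicative (Fin n → ℤ)).toAdd =
        ZtoQ n (f b : Multiplicative (Fin n → ℤ)).toAdd :=
      congrArg (fun c : (ALsub A L).toSubgroup => ZtoQ n (c : Multiplicative (Fin n → ℤ)).toAdd) hab
    rw [hf, hf] at h
    exact Subtype.ext (Multiplicative.toAdd.injective (ZtoQ_injective n
      (Matrix.mulVec_injective_of_isUnit ((Matrix.isUnit_iff_isUnit_det A).2 hA) h)))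
  · obtain ⟨v, hv, h⟩ := mem_ALsub.1 w.2
    refine ⟨⟨Multiplicative.ofAdd v, hv⟩, ?_⟩
    apply Subtype.ext
    apply Multiplicative.toAdd.injective
    apply ZtoQ_injective
    exact (hf _).trans h

theorem exists_mulEquiv_HNNExtension (φ : L.toSubgroup ≃* (ALsub A L).toSubgroup)
    (hφ : ∀ a, ZtoQ n (φ a : Multiplicative (Fin n → ℤ)).toAdd =
        A *ᵥ ZtoQ n (a : Multiplicative (Fin n → ℤ)).toAdd) :
    ∃ e : LM n A L ≃* HNNExtension (Multiplicative (Fin n → ℤ)) _ _ φ,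
      ∀ v, e (XvHom n A L v) = HNNExtension.of v := by
  let f : Fin n ⊕ Unit → HNNExtension (Multiplicative (Fin n → ℤ)) _ _ φ :=
    Sum.elim (fun i => HNNExtension.of (Multiplicative.ofAdd (Pi.single i 1)))
      fun _ => HNNExtension.t
  have hword : ∀ v, FreeGroup.lift f (xWord n v) = HNNExtension.of (Multiplicative.ofAdd v) := by
    intro v
    rw [xWord, map_prod_ofFn_zpow, ← prod_ofFn_single_zpow v, map_prod_ofFn_zpow]
    simp [f]
  have hrels : ∀ r ∈ LMrels n A L, FreeGroup.lift f r = 1 := by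
    rintro r (⟨i, j, rfl⟩ | ⟨v, hv, w, hw, rfl⟩)
    · simp only [map_mul, map_inv, FreeGroup.lift_apply_of, f, Sum.elim_inl]
      rw [mul_inv_eq_one, mul_inv_eq_iff_eq_mul]
      simp only [← map_mul HNNExtension.of, mul_comm]
    · have hφv : (φ ⟨Multiplicative.ofAdd v, hv⟩ : Multiplicative (Fin n → ℤ)) =
          Multiplicative.ofAdd w :=
        Multiplicative.toAdd.injective (ZtoQ_injective n ((hφ _).trans hw.symm))
      have := HNNExtension.t_mul_of (φ := φ) ⟨Multiplicative.ofAdd v, hv⟩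
      rw [hφv] at this
      simp only [map_mul, map_inv, hword, FreeGroup.lift_apply_of, f, Sum.elim_inr]
      rw [mul_inv_eq_one, mul_inv_eq_iff_eq_mul, this]
  let F := PresentedGroup.toGroup hrels
  have hF : ∀ v, F (XvHom n A L v) = HNNExtension.of v := fun v => by
    refine Eq.trans ?_ (hword v.toAdd)
    rw [← ofAdd_toAdd v, XvHom_ofAdd, ← mk_xWord]
    rfl
  have hT : ∀ a : L.toSubgroup, Tg n A L * XvHom n A L a = XvHom n A L (φ a) * Tg n A L :=
    fun a => Tg_conj a.2 (hφ a)
  let K : HNNExtension (Multiplicative (Fin n → ℤ)) _ _ φ →* LM n A L :=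
    HNNExtension.lift (XvHom n A L) (Tg n A L) hT
  have hKt : K HNNExtension.t = Tg n A L := HNNExtension.lift_t _ _ hT
  have hK : ∀ v, K (HNNExtension.of v) = XvHom n A L v := HNNExtension.lift_of _ _ hT
  have hFt : F (Tg n A L) = HNNExtension.t := PresentedGroup.toGroup.of hrels
  have hFx : ∀ i, F (Xg n A L i) = HNNExtension.of (Multiplicative.ofAdd (Pi.single i 1)) :=
    fun i => PresentedGroup.toGroup.of hrels
  refine ⟨MonoidHom.toMulEquiv F K ?_ ?_, hF⟩
  · apply PresentedGroup.ext
    rintro (i | ⟨⟩)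
    · change K (F (Xg n A L i)) = Xg n A L i
      rw [hFx, hK, XvHom_single]
    · change K (F (Tg n A L)) = Tg n A L
      rw [hFt, hKt]
  · apply HNNExtension.hom_ext
    · refine MonoidHom.ext fun v => ?_
      change F (K (HNNExtension.of v)) = HNNExtension.of v
      rw [hK, hF]
    · change F (K HNNExtension.t) = HNNExtension.t
      rw [hKt, hFt]

end LM

/-- **Lemma.** Suppose `L ≠ ℤ^n` and `AL ≠ ℤ^n`.  Then the set
`H₁ = {g ∈ H ∣ C_G(g) ≠ H}` equals `{x^v ∣ v ∈ AL ∪ L}`; in particular `H₁` is a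
subgroup of `H` iff `AL ⊆ L` or `L ⊆ AL`. -/
theorem LM_H1_description
    (n : ℕ) (A : Matrix (Fin n) (Fin n) ℚ) (hA : IsUnit A.det)
    (L : AddSubgroup (Fin n → ℤ)) (hL : L.FiniteIndex)
    (hLA : QImage A L ≤ (ZtoQ n).range)
    (hneL : L ≠ ⊤) (hneAL : ALsub A L ≠ ⊤) :
    {g : LM n A L | g ∈ Hsub n A L ∧ Subgroup.centralizer {g} ≠ Hsub n A L} =
        {x : LM n A L | ∃ v : Fin n → ℤ, (v ∈ ALsub A L ∨ v ∈ L) ∧ x = Xv n A L v} ∧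
      ((∃ S : Subgroup (LM n A L), (S : Set (LM n A L)) =
          {g : LM n A L | g ∈ Hsub n A L ∧ Subgroup.centralizer {g} ≠ Hsub n A L}) ↔
        (ALsub A L ≤ L ∨ L ≤ ALsub A L)) := by
  obtain ⟨φ, hφ⟩ := exists_mulEquiv_ALsub hA hLA
  obtain ⟨e, he⟩ := exists_mulEquiv_HNNExtension φ hφ
  have hinj : Function.Injective (XvHom n A L) := fun v w h =>
    HNNExtension.of_injective φ (by rw [← he, ← he, h])
  have hH : Hsub n A L = (HNNExtension.of (φ := φ)).range.comap e.toMonoidHom := by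
    rw [Hsub_eq_range]
    ext x
    constructor
    · rintro ⟨v, rfl⟩
      exact ⟨v, (he v).symm⟩
    · rintro ⟨v, hv⟩
      exact ⟨v, e.injective ((he v).trans hv)⟩
  have hcent : ∀ v : Fin n → ℤ,
      Subgroup.centralizer {Xv n A L v} = Hsub n A L ↔ ¬ (v ∈ ALsub A L ∨ v ∈ L) := by
    intro v
    have hc : Subgroup.centralizer {Xv n A L v} =
        (Subgroup.centralizer {HNNExtension.of (φ := φ) (Multiplicative.ofAdd v)}).comap
          e.toMonoidHom := by
      ext x
      rw [Subgroup.mem_comap, Subgroup.mem_centralizer_singleton_iff,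
        Subgroup.mem_centralizer_singleton_iff, ← he, XvHom_ofAdd, MulEquiv.coe_toMonoidHom,
        ← map_mul, ← map_mul, e.injective.eq_iff]
    rw [hc, hH, (Subgroup.comap_injective (f := e.toMonoidHom) e.surjective).eq_iff,
      HNNExtension.centralizer_of_eq_range_iff, not_or, and_comm]
    · rfl
    · simpa using hneL
    · simpa using hneAL
  have hset : {g : LM n A L | g ∈ Hsub n A L ∧ Subgroup.centralizer {g} ≠ Hsub n A L} =
      {x : LM n A L | ∃ v : Fin n → ℤ, (v ∈ ALsub A L ∨ v ∈ L) ∧ x = Xv n A L v} := by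
    ext g
    constructor
    · rintro ⟨hg, hne⟩
      rw [Hsub_eq_range] at hg
      obtain ⟨v, rfl⟩ := hg
      exact ⟨v.toAdd, not_not.1 (mt (hcent v.toAdd).2 hne), rfl⟩
    · rintro ⟨v, hv, rfl⟩
      refine ⟨?_, fun h => (hcent v).1 h hv⟩
      rw [Hsub_eq_range]
      exact ⟨Multiplicative.ofAdd v, rfl⟩
  refine ⟨hset, ?_⟩
  rw [hset]
  constructor
  · rintro ⟨S, hS⟩
    have hmem : ∀ v, Xv n A L v ∈ S ↔ (v ∈ ALsub A L ∨ v ∈ L) := by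
      intro v
      rw [← SetLike.mem_coe, hS]
      constructor
      · rintro ⟨w, hw, h⟩
        obtain rfl : v = w := hinj h
        exact hw
      · exact fun hv => ⟨v, hv, rfl⟩
    by_contra! hcon
    obtain ⟨a, ha, ha'⟩ := SetLike.not_le_iff_exists.1 hcon.1
    obtain ⟨b, hb, hb'⟩ := SetLike.not_le_iff_exists.1 hcon.2
    have hab := S.mul_mem ((hmem a).2 (Or.inl ha)) ((hmem b).2 (Or.inr hb))
    rw [← XvHom_ofAdd a, ← XvHom_ofAdd b, ← map_mul, ← ofAdd_add, XvHom_ofAdd, hmem] at hab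
    rcases hab with h | h
    · exact hb' ((add_mem_cancel_left ha).1 h)
    · exact ha' ((add_mem_cancel_right hb).1 h)
  · have key : ∀ M : AddSubgroup (Fin n → ℤ), (∀ v, v ∈ M ↔ (v ∈ ALsub A L ∨ v ∈ L)) →
        ((M.toSubgroup.map (XvHom n A L) : Subgroup (LM n A L)) : Set (LM n A L)) =
          {x : LM n A L | ∃ v : Fin n → ℤ, (v ∈ ALsub A L ∨ v ∈ L) ∧ x = Xv n A L v} := by
      intro M hM
      ext x
      constructor
      · rintro ⟨v, hv, rfl⟩
        exact ⟨v.toAdd, (hM _).1 hv, rfl⟩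
      · rintro ⟨v, hv, rfl⟩
        exact ⟨Multiplicative.ofAdd v, (hM v).2 hv, rfl⟩
    rintro (h | h)
    · exact ⟨_, key L fun v => ⟨Or.inr, fun hv => hv.elim (@h v) id⟩⟩
    · exact ⟨_, key (ALsub A L) fun v => ⟨Or.inl, fun hv => hv.elim id (@h v)⟩⟩
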